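/- Let B be a C*-subalgebra of B(H). Define S_B as the set of all TROs M ⊆ B(H) satisfying cl-span(MB) ⊆ M, cl-span(BM) ⊆ M, cl-span(M*M) ⊆ B, and cl-span(MM*) ⊆ B, with multiplication M·N := cl-span(MN). Then S_B is an inverse semigroup: the product of two such TROs is again in S_B, each M has M* as a generalized inverse (M M* M = M and M* M M* = M*), and every idempotent element E of S_B satisfies E = E* (hence idempotents are ideals of B and commute). -/

import Mathlib

noncomputable section

variable {H : Type*} [NormedAddCommGroup H] [InnerProductSpace ℂ H] [CompleteSpace H]

/-- Closed linear span of a set of bounded operators. -/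
def clspan (A : Set (H →L[ℂ] H)) : Set (H →L[ℂ] H) :=
  closure (Submodule.span ℂ A : Set (H →L[ℂ] H))

/-- Set of all products `a * b` with `a ∈ A`, `b ∈ B`. -/
def pmul (A B : Set (H →L[ℂ] H)) : Set (H →L[ℂ] H) := Set.image2 (· * ·) A B

/-- The set of adjoints of elements of `A`. -/
def sstar (A : Set (H →L[ℂ] H)) : Set (H →L[ℂ] H) := star '' A

/-- `M` is a ternary ring of operators: a norm-closed linear subspace with `M M* M ⊆ M`. -/
structure IsTRO (M : Set (H →L[ℂ] H)) : Prop where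
  isClosed : IsClosed M
  zero_mem : (0 : H →L[ℂ] H) ∈ M
  add_mem : ∀ x ∈ M, ∀ y ∈ M, x + y ∈ M
  smul_mem : ∀ (c : ℂ), ∀ x ∈ M, c • x ∈ M
  mul_mem : ∀ x ∈ M, ∀ y ∈ M, ∀ z ∈ M, x * star y * z ∈ M

/-- `u` is associated to the TRO `M`:  `cl-span(M* u) = cl-span(M* M)` and
`cl-span(u M*) = cl-span(M M*)`. -/
def AssociatedTo (u : H →L[ℂ] H) (M : Set (H →L[ℂ] H)) : Prop :=
  clspan (pmul (sstar M) {u}) = clspan (pmul (sstar M) M) ∧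
  clspan (pmul {u} (sstar M)) = clspan (pmul M (sstar M))

/-- Membership in `S_B`: `M` is a TRO with `MB, BM ⊆ M` and `M*M, MM* ⊆ B`
(closed linear spans). -/
def MemSB (Bs : Set (H →L[ℂ] H)) (M : Set (H →L[ℂ] H)) : Prop :=
  IsTRO M ∧ clspan (pmul M Bs) ⊆ M ∧ clspan (pmul Bs M) ⊆ M ∧
    clspan (pmul (sstar M) M) ⊆ Bs ∧ clspan (pmul M (sstar M)) ⊆ Bs


/-- Closed subspace. -/
structure IsCS (M : Set (H →L[ℂ] H)) : Prop where
  isClosed : IsClosed M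
  zero_mem : (0 : H →L[ℂ] H) ∈ M
  add_mem : ∀ x ∈ M, ∀ y ∈ M, x + y ∈ M
  smul_mem : ∀ (c : ℂ), ∀ x ∈ M, c • x ∈ M

theorem IsTRO.isCS {M : Set (H →L[ℂ] H)} (h : IsTRO M) : IsCS M :=
  ⟨h.isClosed, h.zero_mem, h.add_mem, h.smul_mem⟩

theorem isCS_clspan (A : Set (H →L[ℂ] H)) : IsCS (clspan A) where
  isClosed := isClosed_closure
  zero_mem := (Submodule.span ℂ A).topologicalClosure.zero_mem
  add_mem := fun _ hx _ hy => (Submodule.span ℂ A).topologicalClosure.add_mem hx hy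
  smul_mem := fun c _ hx => (Submodule.span ℂ A).topologicalClosure.smul_mem c hx

theorem isCS_sub (Bs : StarSubalgebra ℂ (H →L[ℂ] H))
    (h : IsClosed (Bs : Set (H →L[ℂ] H))) : IsCS (Bs : Set (H →L[ℂ] H)) where
  isClosed := h
  zero_mem := Bs.zero_mem
  add_mem := fun _ hx _ hy => Bs.add_mem hx hy
  smul_mem := fun c _ hx => Bs.smul_mem hx c

theorem subset_clspan (A : Set (H →L[ℂ] H)) : A ⊆ clspan A :=
  Submodule.subset_span.trans subset_closure

theorem clspan_sub {A M : Set (H →L[ℂ] H)} (hM : IsCS M) (h : A ⊆ M) : clspan A ⊆ M := by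
  let S : Submodule ℂ (H →L[ℂ] H) :=
    { carrier := M, zero_mem' := hM.zero_mem, add_mem' := fun hx hy => hM.add_mem _ hx _ hy,
      smul_mem' := fun c _ hx => hM.smul_mem c _ hx }
  have : Submodule.span ℂ A ≤ S := Submodule.span_le.2 h
  exact closure_minimal this hM.isClosed

theorem IsCS.preL {M : Set (H →L[ℂ] H)} (hM : IsCS M) (a : H →L[ℂ] H) :
    IsCS {x | a * x ∈ M} where
  isClosed := hM.isClosed.preimage (continuous_const.mul continuous_id)
  zero_mem := by simpa using hM.zero_mem
  add_mem := fun x hx y hy => by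
    simpa [mul_add] using hM.add_mem _ hx _ hy
  smul_mem := fun c x hx => by
    have := hM.smul_mem c _ hx
    simpa using this

theorem IsCS.preR {M : Set (H →L[ℂ] H)} (hM : IsCS M) (a : H →L[ℂ] H) :
    IsCS {x | x * a ∈ M} where
  isClosed := hM.isClosed.preimage (continuous_id.mul continuous_const)
  zero_mem := by simpa using hM.zero_mem
  add_mem := fun x hx y hy => by
    simpa [add_mul] using hM.add_mem _ hx _ hy
  smul_mem := fun c x hx => by
    have := hM.smul_mem c _ hx
    simpa using this

theorem IsCS.preStar {M : Set (H →L[ℂ] H)} (hM : IsCS M) :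
    IsCS {x | star x ∈ M} where
  isClosed := hM.isClosed.preimage continuous_star
  zero_mem := by simpa using hM.zero_mem
  add_mem := fun x hx y hy => by
    simpa using hM.add_mem _ hx _ hy
  smul_mem := fun c x hx => by
    have := hM.smul_mem (star c) _ hx
    simpa [star_smul] using this

theorem mem_pmul {A B : Set (H →L[ℂ] H)} {a b : H →L[ℂ] H} (ha : a ∈ A) (hb : b ∈ B) :
    a * b ∈ clspan (pmul A B) := subset_clspan _ ⟨a, ha, b, hb, rfl⟩

theorem pmul_sub {A B M : Set (H →L[ℂ] H)} (hM : IsCS M)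
    (h : ∀ a ∈ A, ∀ b ∈ B, a * b ∈ M) : clspan (pmul A B) ⊆ M := by
  refine clspan_sub hM ?_
  rintro _ ⟨a, ha, b, hb, rfl⟩
  exact h a ha b hb

theorem mem_sstar {A : Set (H →L[ℂ] H)} {x : H →L[ℂ] H} : x ∈ sstar A ↔ star x ∈ A := by
  constructor
  · rintro ⟨y, hy, rfl⟩; simpa using hy
  · intro h; exact ⟨_, h, star_star x⟩

theorem sstar_eq (A : Set (H →L[ℂ] H)) : sstar A = {x | star x ∈ A} := by
  ext x; exact mem_sstar

theorem memSB_iff (Bs : StarSubalgebra ℂ (H →L[ℂ] H))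
    (h : IsClosed (Bs : Set (H →L[ℂ] H))) (M : Set (H →L[ℂ] H)) :
    MemSB (Bs : Set (H →L[ℂ] H)) M ↔ IsCS M ∧ (∀ x ∈ M, ∀ b ∈ Bs, x * b ∈ M) ∧
      (∀ b ∈ Bs, ∀ x ∈ M, b * x ∈ M) ∧ (∀ x ∈ M, ∀ y ∈ M, star x * y ∈ Bs) ∧
      (∀ x ∈ M, ∀ y ∈ M, x * star y ∈ Bs) := by
  constructor
  · rintro ⟨h0, h1, h2, h3, h4⟩
    exact ⟨h0.isCS, fun x hx b hb => h1 (mem_pmul hx hb), fun b hb x hx => h2 (mem_pmul hb hx),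
      fun x hx y hy => h3 (mem_pmul ⟨x, hx, rfl⟩ hy),
      fun x hx y hy => h4 (mem_pmul hx ⟨y, hy, rfl⟩)⟩
  · rintro ⟨h0, h1, h2, h3, h4⟩
    refine ⟨⟨h0.isClosed, h0.zero_mem, h0.add_mem, h0.smul_mem, ?_⟩,
      pmul_sub h0 h1, pmul_sub h0 h2, pmul_sub (isCS_sub Bs h) ?_, pmul_sub (isCS_sub Bs h) ?_⟩
    · intro x hx y hy z hz
      exact h2 _ (h4 x hx y hy) z hz
    · rintro _ ⟨x, hx, rfl⟩ y hy
      exact h3 x hx y hy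
    · rintro x hx _ ⟨y, hy, rfl⟩
      exact h4 x hx y hy

theorem scalar_bound (n : ℕ) (s : ℝ) (h0 : 0 ≤ s) (h1 : s ≤ 1) :
    s * (1 - s) ^ n ≤ 1 / (n + 1) := by
  have hb := one_add_mul_le_pow (a := s) (by linarith) n
  have hp : 0 ≤ (1 - s) ^ n := pow_nonneg (by linarith) n
  have h2 : (1 - s) ^ n * (1 + s) ^ n ≤ 1 := by
    rw [← mul_pow]
    exact pow_le_one₀ (by nlinarith) (by nlinarith)
  have h3 : (1 - s) ^ n ≤ 1 := pow_le_one₀ (by linarith) (by linarith)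
  have h4 := mul_le_mul_of_nonneg_left hb hp
  have h5 : s * (1 - s) ^ n ≤ (1 - s) ^ n := by nlinarith
  rw [le_div_iff₀ (by positivity)]
  nlinarith

theorem norm_bound (x : H →L[ℂ] H) (hx : ‖x‖ ≤ 1) (n : ℕ) :
    ‖x * (1 - star x * x) ^ n‖ ^ 2 ≤ 1 / ((n + n : ℕ) + 1) := by
  set t := star x * x with ht
  have htsa : IsSelfAdjoint t := IsSelfAdjoint.star_mul_self x
  have htn : 0 ≤ t := star_mul_self_nonneg x
  have hnorm : ‖t‖ ≤ 1 := by
    rw [ht, CStarRing.norm_star_mul_self]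
    nlinarith [norm_nonneg x]
  have e1 : star (x * (1 - t) ^ n) * (x * (1 - t) ^ n) = t * (1 - t) ^ (n + n) := by
    have hc : Commute ((1 - t) ^ n) t :=
      ((Commute.one_left t).sub_left (Commute.refl t)).pow_left n
    rw [star_mul, star_pow, star_sub, star_one, htsa.star_eq, pow_add]
    calc (1 - t) ^ n * star x * (x * (1 - t) ^ n) = (1 - t) ^ n * t * (1 - t) ^ n := by
          rw [ht]; simp only [mul_assoc]
      _ = _ := by rw [hc.eq, mul_assoc]
  have e2 : t * (1 - t) ^ (n + n) = cfc (fun s : ℝ => s * (1 - s) ^ (n + n)) t := by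
    rw [cfc_mul (fun s : ℝ => s) (fun s : ℝ => (1 - s) ^ (n + n)) t,
      cfc_pow (fun s : ℝ => 1 - s) (n + n) t, cfc_sub (fun _ : ℝ => 1) (fun s : ℝ => s) t,
      cfc_id' ℝ t, cfc_const_one ℝ t]
  rw [sq, ← CStarRing.norm_star_mul_self, e1, e2]
  refine norm_cfc_le (by positivity) ?_
  intro s hs
  have h0 : 0 ≤ s := spectrum_nonneg_of_nonneg htn hs
  have h1 : s ≤ 1 := by
    by_cases hH : Nontrivial (H →L[ℂ] H)
    · have := spectrum.norm_le_norm_of_mem hs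
      rw [Real.norm_eq_abs] at this
      exact (le_abs_self s).trans (this.trans hnorm)
    · rw [not_nontrivial_iff_subsingleton] at hH
      simp [spectrum.of_subsingleton] at hs
  rw [Real.norm_of_nonneg (mul_nonneg h0 (pow_nonneg (by linarith) _))]
  exact scalar_bound _ s h0 h1

theorem key {M T : Set (H →L[ℂ] H)} (hM : IsCS M)
    (hm : ∀ x ∈ M, ∀ y ∈ M, ∀ z ∈ M, x * star y * z ∈ M) (hT : IsCS T)
    (h : ∀ a ∈ M, ∀ b ∈ M, ∀ c ∈ M, a * star b * c ∈ T) : M ⊆ T := by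
  have main : ∀ x ∈ M, ‖x‖ ≤ 1 → x ∈ T := by
    intro x hx hn
    have neg : ∀ {S : Set (H →L[ℂ] H)}, IsCS S → ∀ a ∈ S, ∀ b ∈ S, a - b ∈ S := by
      intro S hS a ha b hb
      have := hS.add_mem _ ha _ (hS.smul_mem (-1) _ hb)
      simpa [sub_eq_add_neg] using this
    have ind : ∀ n : ℕ, x * (1 - star x * x) ^ n ∈ M ∧ x - x * (1 - star x * x) ^ n ∈ T := by
      intro n
      induction n with
      | zero => exact ⟨by simpa using hx, by simpa using hT.zero_mem⟩
      | succ k ih =>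
        set y := x * (1 - star x * x) ^ k with hy
        have e : x * (1 - star x * x) ^ (k + 1) = y - y * star x * x := by
          rw [pow_succ, ← mul_assoc, ← hy, mul_sub, mul_one, mul_assoc y]
        rw [e]
        refine ⟨neg hM _ ih.1 _ (hm _ ih.1 _ hx _ hx), ?_⟩
        have := hT.add_mem _ ih.2 _ (h _ ih.1 _ hx _ hx)
        convert this using 1
        abel
    have l0 : Filter.Tendsto (fun n : ℕ => x * (1 - star x * x) ^ n) Filter.atTop (nhds 0) := by
      rw [tendsto_zero_iff_norm_tendsto_zero]
      have l1 : Filter.Tendsto (fun n : ℕ => ‖x * (1 - star x * x) ^ n‖ ^ 2)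
          Filter.atTop (nhds 0) := by
        refine squeeze_zero (fun n => by positivity) (fun n => ?_)
          tendsto_one_div_add_atTop_nhds_zero_nat
        refine (norm_bound x hn n).trans ?_
        gcongr
        omega
      have := l1.sqrt
      simpa [Real.sqrt_sq (norm_nonneg _)] using this
    have l2 : Filter.Tendsto (fun n : ℕ => x - x * (1 - star x * x) ^ n) Filter.atTop (nhds x) := by
      simpa using (tendsto_const_nhds (x := x)).sub l0
    exact hT.isClosed.mem_of_tendsto l2 (Filter.Eventually.of_forall fun n => (ind n).2)
  intro x hx
  by_cases hx0 : x = 0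
  · rw [hx0]; exact hT.zero_mem
  have hn : (‖x‖ : ℂ) ≠ 0 := by exact_mod_cast norm_ne_zero_iff.2 hx0
  have := hT.smul_mem (‖x‖ : ℂ) _ (main ((‖x‖ : ℂ)⁻¹ • x) (hM.smul_mem _ _ hx) (by
    rw [norm_smul, norm_inv, Complex.norm_real, norm_norm,
      inv_mul_cancel₀ (norm_ne_zero_iff.2 hx0)]))
  rwa [smul_inv_smul₀ hn] at this

section parts

variable {Bs : StarSubalgebra ℂ (H →L[ℂ] H)} (hB : IsClosed (Bs : Set (H →L[ℂ] H)))

theorem MemSB.key {M T : Set (H →L[ℂ] H)} (hM : MemSB (Bs : Set (H →L[ℂ] H)) M)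
    (hT : IsCS T) (h : ∀ a ∈ M, ∀ b ∈ M, ∀ c ∈ M, a * star b * c ∈ T) : M ⊆ T :=
  _root_.key hM.1.isCS hM.1.mul_mem hT h

theorem memSB_sstar (hB : IsClosed (Bs : Set (H →L[ℂ] H))) {M : Set (H →L[ℂ] H)}
    (hM : MemSB (Bs : Set (H →L[ℂ] H)) M) : MemSB (Bs : Set (H →L[ℂ] H)) (sstar M) := by
  rw [memSB_iff Bs hB] at hM ⊢
  obtain ⟨h0, h1, h2, h3, h4⟩ := hM
  refine ⟨by rw [sstar_eq]; exact h0.preStar, ?_, ?_, ?_, ?_⟩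
  · intro x hx b hb
    rw [mem_sstar] at hx ⊢
    rw [star_mul]
    exact h2 _ (star_mem hb) _ hx
  · intro b hb x hx
    rw [mem_sstar] at hx ⊢
    rw [star_mul]
    exact h1 _ hx _ (star_mem hb)
  · intro x hx y hy
    rw [mem_sstar] at hx hy
    simpa using h4 _ hx _ hy
  · intro x hx y hy
    rw [mem_sstar] at hx hy
    simpa using h3 _ hx _ hy

theorem memSB_mul (hB : IsClosed (Bs : Set (H →L[ℂ] H))) {M N : Set (H →L[ℂ] H)}
    (hM : MemSB (Bs : Set (H →L[ℂ] H)) M) (hN : MemSB (Bs : Set (H →L[ℂ] H)) N) :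
    MemSB (Bs : Set (H →L[ℂ] H)) (clspan (pmul M N)) := by
  rw [memSB_iff Bs hB] at hM hN ⊢
  obtain ⟨h0, h1, h2, h3, h4⟩ := hM
  obtain ⟨k0, k1, k2, k3, k4⟩ := hN
  have hBC := isCS_sub Bs hB
  have hC := isCS_clspan (pmul M N)
  refine ⟨hC, ?_, ?_, ?_, ?_⟩
  · intro x hx b hb
    refine pmul_sub (hC.preR b) ?_ hx
    intro m hm n hn
    show m * n * b ∈ clspan (pmul M N)
    rw [mul_assoc]
    exact mem_pmul hm (k1 _ hn _ hb)
  · intro b hb x hx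
    refine pmul_sub (hC.preL b) ?_ hx
    intro m hm n hn
    show b * (m * n) ∈ clspan (pmul M N)
    rw [← mul_assoc]
    exact mem_pmul (h2 _ hb _ hm) hn
  · intro x hx y hy
    refine pmul_sub (hBC.preL (star x)) ?_ hy
    intro m hm n hn
    refine pmul_sub (hBC.preR (m * n)).preStar ?_ hx
    intro m' hm' n' hn'
    show star (m' * n') * (m * n) ∈ Bs
    have e : star (m' * n') * (m * n) = star n' * ((star m' * m) * n) := by
      simp only [star_mul, mul_assoc]
    rw [e]
    exact k3 _ hn' _ (k2 _ (h3 _ hm' _ hm) _ hn)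
  · intro x hx y hy
    refine pmul_sub (hBC.preR (star y)) ?_ hx
    intro m hm n hn
    refine pmul_sub (hBC.preL (m * n)).preStar ?_ hy
    intro m' hm' n' hn'
    show m * n * star (m' * n') ∈ Bs
    have e : m * n * star (m' * n') = (m * (n * star n')) * star m' := by
      simp only [star_mul, mul_assoc]
    rw [e]
    exact h4 _ (h1 _ hm _ (k4 _ hn _ hn')) _ hm'

theorem memSB_inv (hB : IsClosed (Bs : Set (H →L[ℂ] H))) {M : Set (H →L[ℂ] H)}
    (hM : MemSB (Bs : Set (H →L[ℂ] H)) M) :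
    clspan (pmul (clspan (pmul M (sstar M))) M) = M := by
  apply Set.Subset.antisymm
  · have h := (memSB_iff Bs hB M).1 hM
    exact pmul_sub h.1 fun a ha b hb => h.2.2.1 a (hM.2.2.2.2 ha) b hb
  · exact hM.key (isCS_clspan _) fun a ha b hb c hc => mem_pmul (mem_pmul ha ⟨b, hb, rfl⟩) hc

theorem sstar_sstar (M : Set (H →L[ℂ] H)) : sstar (sstar M) = M := by
  ext x; simp [mem_sstar]

theorem idem_sub (hB : IsClosed (Bs : Set (H →L[ℂ] H))) {E : Set (H →L[ℂ] H)}
    (hE : MemSB (Bs : Set (H →L[ℂ] H)) E) (hi : clspan (pmul E E) = E) : E ⊆ Bs := by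
  have hBC := isCS_sub Bs hB
  obtain ⟨h0, h1, h2, h3, h4⟩ := (memSB_iff Bs hB E).1 hE
  refine hE.key hBC ?_
  intro a ha b hb c hc
  rw [← hi] at hb
  refine pmul_sub ((hBC.preR c).preL a).preStar ?_ hb
  intro m hm n hn
  show a * (star (m * n)) * c ∈ Bs
  have e : a * (star (m * n)) * c = (a * star n) * (star m * c) := by
    simp only [star_mul, mul_assoc]
  rw [e]
  exact Bs.mul_mem (h4 _ ha _ hn) (h3 _ hm _ hc)

theorem idem_star (hB : IsClosed (Bs : Set (H →L[ℂ] H))) {E : Set (H →L[ℂ] H)}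
    (hE : MemSB (Bs : Set (H →L[ℂ] H)) E) (hi : clspan (pmul E E) = E) : sstar E = E := by
  have hEB := idem_sub hB hE hi
  obtain ⟨h0, h1, h2, h3, h4⟩ := (memSB_iff Bs hB E).1 hE
  have hs : sstar E ⊆ E := by
    refine (memSB_sstar hB hE).key h0 ?_
    intro a ha b hb c hc
    rw [mem_sstar] at ha hb hc
    have ha' : a ∈ Bs := by simpa using star_mem (hEB ha)
    have hc' : c ∈ Bs := by simpa using star_mem (hEB hc)
    exact h1 _ (h2 _ ha' _ hb) _ hc'
  refine hs.antisymm fun x hx => ?_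
  rw [mem_sstar]
  exact hs ⟨x, hx, rfl⟩

theorem idem_comm (hB : IsClosed (Bs : Set (H →L[ℂ] H))) {E F : Set (H →L[ℂ] H)}
    (hE : MemSB (Bs : Set (H →L[ℂ] H)) E) (hF : MemSB (Bs : Set (H →L[ℂ] H)) F)
    (hi : clspan (pmul E E) = E) (hj : clspan (pmul F F) = F) :
    clspan (pmul E F) ⊆ clspan (pmul F E) := by
  have hEB := idem_sub hB hE hi
  have hFB := idem_sub hB hF hj
  have hEs := idem_star hB hE hi
  obtain ⟨h0, h1, h2, h3, h4⟩ := (memSB_iff Bs hB E).1 hE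
  obtain ⟨k0, k1, k2, k3, k4⟩ := (memSB_iff Bs hB F).1 hF
  have gE : clspan (pmul E F) ⊆ E := pmul_sub h0 fun a ha b hb => h1 a ha b (hFB hb)
  have gF : clspan (pmul E F) ⊆ F := pmul_sub k0 fun a ha b hb => k2 a (hEB ha) b hb
  refine (memSB_mul hB hE hF).key (isCS_clspan _) ?_
  intro a ha b hb c hc
  rw [mul_assoc]
  refine mem_pmul (gF ha) (h1 _ ?_ _ (hEB (gE hc)))
  rw [← hEs]
  exact ⟨b, gE hb, rfl⟩

end parts

/-- For a C*-subalgebra `B ⊆ B(H)`, the set `S_B` of TROs `M` with `MB, BM ⊆ M` and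
`M*M, MM* ⊆ B`, with multiplication `M·N := cl-span(MN)`, is an inverse semigroup:
it is closed under multiplication, `M*` is a generalized inverse of `M`, every
idempotent `E` satisfies `E = E*`, and idempotents commute. -/
theorem stmt13 (Bs : StarSubalgebra ℂ (H →L[ℂ] H)) (hBclosed : IsClosed (Bs : Set (H →L[ℂ] H))) :
    (∀ M N : Set (H →L[ℂ] H), MemSB (Bs : Set (H →L[ℂ] H)) M →
        MemSB (Bs : Set (H →L[ℂ] H)) N → MemSB (Bs : Set (H →L[ℂ] H)) (clspan (pmul M N))) ∧
    (∀ M : Set (H →L[ℂ] H), MemSB (Bs : Set (H →L[ℂ] H)) M →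
        clspan (pmul (clspan (pmul M (sstar M))) M) = M ∧
        clspan (pmul (clspan (pmul (sstar M) M)) (sstar M)) = sstar M) ∧
    (∀ E : Set (H →L[ℂ] H), MemSB (Bs : Set (H →L[ℂ] H)) E →
        clspan (pmul E E) = E → sstar E = E) ∧
    (∀ E F : Set (H →L[ℂ] H), MemSB (Bs : Set (H →L[ℂ] H)) E →
        MemSB (Bs : Set (H →L[ℂ] H)) F → clspan (pmul E E) = E → clspan (pmul F F) = F →
        clspan (pmul E F) = clspan (pmul F E)) := by
  exact ⟨fun M N hM hN => memSB_mul hBclosed hM hN,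
    fun M hM => ⟨memSB_inv hBclosed hM, by
      have := memSB_inv hBclosed (memSB_sstar hBclosed hM)
      rwa [sstar_sstar] at this⟩,
    fun E hE hi => idem_star hBclosed hE hi,
    fun E F hE hF hi hj => (idem_comm hBclosed hE hF hi hj).antisymm
      (idem_comm hBclosed hF hE hj hi)⟩
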